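/- The number of contours (self-avoiding closed circuits) in the dual square lattice surrounding the origin with n bonds, r sides, and m sides of length one is at most (n²/4)·2^r·C(r,m)·C(n-r-1, r-m-1). -/

import Mathlib

/-- A step of a contour is a unit lattice step. -/
def UnitStep (v : ℤ × ℤ) : Prop :=
  v = (1, 0) ∨ v = (-1, 0) ∨ v = (0, 1) ∨ v = (0, -1)

/-- A contour on the (dual) square lattice: a closed self-avoiding cycle with
unit lattice steps, parametrized cyclically by `Fin n`. -/
def IsContour {n : ℕ} [NeZero n] (γ : Fin n → ℤ × ℤ) : Prop :=
  Function.Injective γ ∧ ∀ i : Fin n, UnitStep (γ (i + 1) - γ i)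

/-- The contour surrounds the origin of the primal lattice: the positive horizontal
ray from the origin crosses an odd number of edges of the contour.  Here the dual
vertex `(a, b)` stands for `(a + 1/2, b + 1/2)`, so the crossed edges are the
vertical edges joining `(a, -1)` and `(a, 0)` with `a ≥ 0`. -/
def Surrounds {n : ℕ} [NeZero n] (γ : Fin n → ℤ × ℤ) : Prop :=
  Odd (Finset.univ.filter (fun i : Fin n =>
    (γ i).1 = (γ (i + 1)).1 ∧ 0 ≤ (γ i).1 ∧
      (((γ i).2 = -1 ∧ (γ (i + 1)).2 = 0) ∨ ((γ i).2 = 0 ∧ (γ (i + 1)).2 = -1)))).card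

/-- The number of sides (direction changes) of the contour. -/
def rCount {n : ℕ} [NeZero n] (γ : Fin n → ℤ × ℤ) : ℕ :=
  (Finset.univ.filter (fun i : Fin n => γ (i + 1) - γ i ≠ γ i - γ (i - 1))).card

/-- The number of sides of length one of the contour: edges at which the direction
changes both before and after. -/
def mCount {n : ℕ} [NeZero n] (γ : Fin n → ℤ × ℤ) : ℕ :=
  (Finset.univ.filter (fun i : Fin n =>
    γ (i + 1) - γ i ≠ γ i - γ (i - 1) ∧
      γ (i + 1 + 1) - γ (i + 1) ≠ γ (i + 1) - γ i)).card

/-- The set of edges of a contour, as unordered pairs of dual vertices. -/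
def edgeSet {n : ℕ} [NeZero n] (γ : Fin n → ℤ × ℤ) : Set (Sym2 (ℤ × ℤ)) :=
  Set.range (fun i : Fin n => s(γ i, γ (i + 1)))

/-- The number of places where an entry `some _` of a list is followed by `none`. -/
def descents : List (Option Bool) → ℕ
  | [] => 0
  | a :: l => descents l + if a.isSome ∧ l.head? = some none then 1 else 0

/-- The number of compositions of `z` into `g` positive parts. -/
def compositionCount : ℕ → ℕ → ℕ
  | 0, 0 => 1
  | 0, _ + 1 => 0
  | _ + 1, 0 => 0
  | z + 1, g + 1 => z.choose g

theorem compositionCount_succ (z g : ℕ) :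
    compositionCount (z + 1) (g + 1) = compositionCount z g + compositionCount z (g + 1) := by
  rcases z with _ | z <;> rcases g with _ | g <;> simp [compositionCount, Nat.choose_succ_succ]

theorem compositionCount_le_choose (z g : ℕ) :
    compositionCount z g ≤ (z - 1).choose (g - 1) := by
  rcases z with _ | z <;> rcases g with _ | g <;> simp [compositionCount]

/-- Turn words with `r` turns, `z` straight entries and `g` descents. -/
def turnWords (r z g : ℕ) : Set (List (Option Bool)) :=
  {l | l.countP Option.isSome = r ∧ l.countP Option.isNone = z ∧ descents l = g}

/-- Turn words that do not begin with a straight entry. -/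
def turnWordsTurning (r z g : ℕ) : Set (List (Option Bool)) :=
  {l ∈ turnWords r z g | l.head? ≠ some none}

/-- Turn words that begin with a straight entry. -/
def turnWordsStraight (r z g : ℕ) : Set (List (Option Bool)) :=
  {l ∈ turnWords r z g | l.head? = some none}

theorem turnWordsTurning_zero_subset (z g : ℕ) :
    turnWordsTurning 0 z g ⊆ {l | l = [] ∧ z = 0 ∧ g = 0} := by
  rintro (_ | ⟨_ | b, l⟩) ⟨⟨h₁, h₂, h₃⟩, h₄⟩ <;> simp_all [descents]

theorem turnWordsTurning_succ_zero_subset (r z : ℕ) :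
    turnWordsTurning (r + 1) z 0 ⊆ ⋃ b : Bool, List.cons (some b) '' turnWordsTurning r z 0 := by
  rintro (_ | ⟨_ | b, l⟩) ⟨⟨h₁, h₂, h₃⟩, h₄⟩
  · simp at h₁
  · simp at h₄
  · have h₅ : l.head? ≠ some none := by
      intro h
      simp [descents, h] at h₃
    refine Set.mem_iUnion.2 ⟨b, l, ⟨⟨?_, ?_, ?_⟩, h₅⟩, rfl⟩ <;> simp_all [descents]

theorem turnWordsTurning_succ_succ_subset (r z g : ℕ) :
    turnWordsTurning (r + 1) z (g + 1) ⊆ ⋃ b : Bool, List.cons (some b) ''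
      (turnWordsTurning r z (g + 1) ∪ turnWordsStraight r z g) := by
  rintro (_ | ⟨_ | b, l⟩) ⟨⟨h₁, h₂, h₃⟩, h₄⟩
  · simp at h₁
  · simp at h₄
  · refine Set.mem_iUnion.2 ⟨b, l, ?_, rfl⟩
    by_cases h₅ : l.head? = some none
    · refine Or.inr ⟨⟨?_, ?_, ?_⟩, h₅⟩ <;> simp_all [descents]
    · refine Or.inl ⟨⟨?_, ?_, ?_⟩, h₅⟩ <;> simp_all [descents]

theorem turnWordsStraight_zero (r g : ℕ) : turnWordsStraight r 0 g = ∅ := by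
  ext (_ | ⟨_ | b, l⟩) <;> simp [turnWordsStraight, turnWords]

theorem turnWordsStraight_succ_subset (r z g : ℕ) :
    turnWordsStraight r (z + 1) g ⊆ List.cons none ''
      (turnWordsTurning r z g ∪ turnWordsStraight r z g) := by
  rintro (_ | ⟨_ | b, l⟩) ⟨⟨h₁, h₂, h₃⟩, h₄⟩
  · simp at h₄
  · refine ⟨l, ?_, rfl⟩
    by_cases h₅ : l.head? = some none
    · refine Or.inr ⟨⟨?_, ?_, ?_⟩, h₅⟩ <;> simp_all [descents]
    · refine Or.inl ⟨⟨?_, ?_, ?_⟩, h₅⟩ <;> simp_all [descents]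
  · simp at h₄

theorem encard_iUnion_bool_image_le (s : Set (List (Option Bool))) :
    (⋃ b : Bool, List.cons (some b) '' s).encard ≤ 2 * s.encard := by
  rw [Set.iUnion, iSup_bool_eq, two_mul]
  exact (Set.encard_union_le _ _).trans (add_le_add (Set.encard_image_le _ _)
    (Set.encard_image_le _ _))

theorem encard_turnWords_le (k r z g : ℕ) (hk : r + z = k) :
    (turnWordsTurning r z g).encard ≤ (2 ^ r * r.choose g * compositionCount z g : ℕ) ∧
    (turnWordsStraight r z g).encard ≤
      (2 ^ r * r.choose g * compositionCount z (g + 1) : ℕ) := by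
  induction k generalizing r z g with
  | zero =>
    obtain ⟨rfl, rfl⟩ : r = 0 ∧ z = 0 := by omega
    refine ⟨?_, by simp [turnWordsStraight_zero]⟩
    refine (Set.encard_le_encard (turnWordsTurning_zero_subset 0 g)).trans ?_
    rcases g with _ | g <;> simp [compositionCount]
  | succ k ih =>
    constructor
    · rcases r with _ | r
      · refine (Set.encard_le_encard (turnWordsTurning_zero_subset z g)).trans ?_
        obtain ⟨z, rfl⟩ : ∃ y, z = y + 1 := ⟨k, by omega⟩
        simp
      · rcases g with _ | g
        · refine (Set.encard_le_encard (turnWordsTurning_succ_zero_subset r z)).trans ?_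
          refine (encard_iUnion_bool_image_le _).trans ?_
          refine (mul_le_mul_right (ih r z 0 (by omega)).1 2).trans ?_
          norm_cast
          apply le_of_eq
          simp
          ring
        · refine (Set.encard_le_encard (turnWordsTurning_succ_succ_subset r z g)).trans ?_
          refine (encard_iUnion_bool_image_le _).trans ?_
          refine (mul_le_mul_right ((Set.encard_union_le _ _).trans
            (add_le_add (ih r z (g + 1) (by omega)).1 (ih r z g (by omega)).2)) 2).trans ?_
          norm_cast
          apply le_of_eq
          rw [Nat.choose_succ_succ]
          ring
    · rcases z with _ | z
      · simp [turnWordsStraight_zero]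
      · refine (Set.encard_le_encard (turnWordsStraight_succ_subset r z g)).trans ?_
        refine (Set.encard_image_le _ _).trans ?_
        refine ((Set.encard_union_le _ _).trans
            (add_le_add (ih r z g (by omega)).1 (ih r z g (by omega)).2)).trans ?_
        norm_cast
        apply le_of_eq
        rw [compositionCount_succ]
        ring

/-- The word formed by the first `n` values of `f`. -/
def wordOf (f : ℕ → Option Bool) (n : ℕ) : List (Option Bool) :=
  (List.range n).map f

theorem wordOf_succ (f : ℕ → Option Bool) (n : ℕ) :
    wordOf f (n + 1) = f 0 :: wordOf (fun k => f (k + 1)) n := by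
  simp [wordOf, List.range_succ_eq_map, Function.comp_def]

theorem countP_wordOf (p : Option Bool → Bool) (f : ℕ → Option Bool) (n : ℕ) :
    (wordOf f n).countP p = ∑ k ∈ Finset.range n, if p (f k) then 1 else 0 := by
  induction n generalizing f with
  | zero => simp [wordOf]
  | succ n ih => rw [wordOf_succ, List.countP_cons, ih, Finset.sum_range_succ']

theorem descents_wordOf (f : ℕ → Option Bool) (n : ℕ) (hf : (f n).isSome) :
    descents (wordOf f n) =
      ∑ k ∈ Finset.range n, if (f k).isSome ∧ ¬ (f (k + 1)).isSome then 1 else 0 := by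
  induction n generalizing f with
  | zero => simp [wordOf, descents]
  | succ n ih =>
    rw [wordOf_succ, descents, ih _ hf, Finset.sum_range_succ']
    congr 2
    rcases n with _ | n
    · simp_all [wordOf]
    · simp [wordOf_succ]

section Cycles

open scoped Fin.CommRing Fin.NatCast

variable {n : ℕ} [NeZero n]

theorem even_card_ne_succ (s : Fin n → Bool) :
    Even (Finset.univ.filter fun i : Fin n => s i ≠ s (i + 1)).card := by
  rw [← ZMod.natCast_eq_zero_iff_even, Finset.card_filter]
  push_cast
  have h (i : Fin n) : (if s i ≠ s (i + 1) then 1 else 0 : ZMod 2) =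
      (if s (i + 1) then 1 else 0) - (if s i then 1 else 0) := by
    cases s i <;> cases s (i + 1) <;> simp
  rw [Finset.sum_congr rfl fun i _ => h i, Finset.sum_sub_distrib, sub_eq_zero]
  exact Equiv.sum_comp (Equiv.addRight (1 : Fin n)) fun i => if s i then (1 : ZMod 2) else 0

theorem add_natCast_sub_le (f : Fin n → ℤ) (hf : ∀ i, f (i + 1) - f i ≤ 1) (i : Fin n) (k : ℕ) :
    f (i + k) - f i ≤ k := by
  induction k with
  | zero => simp
  | succ k ih =>
    have := hf (i + k)
    push_cast
    rw [← add_assoc]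
    omega

/-- Two values of a cyclic sequence of length `n` with increments in `[-1, 1]` differ by at
most `n / 2`. -/
theorem two_mul_sub_le (f : Fin n → ℤ) (hf : ∀ i, |f (i + 1) - f i| ≤ 1) (p q : Fin n) :
    2 * (f p - f q) ≤ n := by
  have h₁ := add_natCast_sub_le f (fun i => (abs_le.1 (hf i)).2) q (p - q).val
  have h₂ := add_natCast_sub_le (fun i => -f i)
    (fun i => by have := (abs_le.1 (hf i)).1; omega) p (n - (p - q).val)
  have h₃ := (p - q).isLt
  rw [Nat.cast_sub h₃.le] at h₂
  push_cast [Nat.cast_sub h₃.le] at h₂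
  simp only [Fin.cast_val_eq_self, Fin.natCast_self, zero_sub, neg_sub, add_sub_cancel] at h₁ h₂
  omega

/-- The step leaving the vertex with index `i`. -/
def step (γ : Fin n → ℤ × ℤ) (i : Fin n) : ℤ × ℤ := γ (i + 1) - γ i

theorem step_sub_one (γ : Fin n → ℤ × ℤ) (i : Fin n) : step γ (i - 1) = γ i - γ (i - 1) := by
  simp [step]

theorem rCount_eq (γ : Fin n → ℤ × ℤ) :
    rCount γ = (Finset.univ.filter fun i : Fin n => step γ i ≠ step γ (i - 1)).card := by
  simp only [rCount, step, sub_add_cancel]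

theorem mCount_eq (γ : Fin n → ℤ × ℤ) :
    mCount γ = (Finset.univ.filter fun i : Fin n =>
      step γ i ≠ step γ (i - 1) ∧ step γ (i + 1) ≠ step γ i).card := by
  simp only [mCount, step, sub_add_cancel]

theorem UnitStep.neg {v : ℤ × ℤ} (h : UnitStep v) : UnitStep (-v) := by
  rcases h with rfl | rfl | rfl | rfl <;> simp [UnitStep]

theorem UnitStep.abs_le {v : ℤ × ℤ} (h : UnitStep v) : |v.1| ≤ 1 ∧ |v.2| ≤ 1 := by
  rcases h with rfl | rfl | rfl | rfl <;> simp

theorem step_rotate (γ : Fin n → ℤ × ℤ) (c i : Fin n) :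
    step (fun j => γ (j + c)) i = step γ (i + c) := by
  simp only [step, add_right_comm]

theorem step_reverse (γ : Fin n → ℤ × ℤ) (i : Fin n) :
    step (fun j => γ (-j)) i = -step γ (-i - 1) := by
  simp only [step, sub_add_cancel, neg_sub, neg_add']

/-- `γ'` is a contour sharing with `γ` the data that do not depend on the parametrization. -/
def SameContour (γ γ' : Fin n → ℤ × ℤ) : Prop :=
  IsContour γ' ∧ rCount γ' = rCount γ ∧ mCount γ' = mCount γ ∧ edgeSet γ' = edgeSet γ ∧
    Set.range γ' = Set.range γ

theorem sameContour_rotate {γ : Fin n → ℤ × ℤ} (hγ : IsContour γ) (c : Fin n) :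
    SameContour γ fun j => γ (j + c) := by
  refine ⟨⟨hγ.1.comp (add_left_injective c), fun i => ?_⟩, ?_, ?_, ?_, ?_⟩
  · simpa only [add_right_comm] using hγ.2 (i + c)
  · simp only [rCount_eq, step_rotate]
    refine Finset.card_equiv (Equiv.addRight c) fun i => ?_
    simp [add_sub_right_comm]
  · simp only [mCount_eq, step_rotate]
    refine Finset.card_equiv (Equiv.addRight c) fun i => ?_
    simp [add_sub_right_comm, add_right_comm]
  · simp only [edgeSet, add_right_comm _ (1 : Fin n) c]
    exact (Equiv.addRight c).surjective.range_comp fun i => s(γ i, γ (i + 1))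
  · exact (Equiv.addRight c).surjective.range_comp γ

theorem sameContour_reverse {γ : Fin n → ℤ × ℤ} (hγ : IsContour γ) :
    SameContour γ fun j => γ (-j) := by
  refine ⟨⟨hγ.1.comp neg_injective, fun i => ?_⟩, ?_, ?_, ?_, ?_⟩
  · simpa only [sub_add_cancel, neg_sub, neg_add'] using (hγ.2 (-i - 1)).neg
  · simp only [rCount_eq, step_reverse]
    refine Finset.card_equiv (Equiv.neg _) fun i => ?_
    simp [eq_comm]
  · simp only [mCount_eq, step_reverse]
    refine Finset.card_equiv ((Equiv.neg _).trans (Equiv.subRight 1)) fun i => ?_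
    have h₁ : -(i - 1) - 1 = -i := by ring
    have h₂ : -(i + 1) - 1 = -i - 1 - 1 := by ring
    have h₃ : -i - 1 + 1 = -i := by ring
    simp only [Finset.mem_filter, Finset.mem_univ, true_and, ne_eq, neg_inj, h₁, h₂,
      Equiv.trans_apply, Equiv.neg_apply, Equiv.subRight_apply, h₃]
    rw [and_comm, eq_comm, eq_comm (a := step γ (-i - 1)) (b := step γ (-i))]
  · rw [edgeSet, edgeSet, ← ((Equiv.neg (Fin n)).trans (Equiv.subRight 1)).surjective.range_comp
      fun i => s(γ i, γ (i + 1))]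
    congr 1
    ext1 i
    simp only [Function.comp_apply, Equiv.trans_apply, Equiv.neg_apply, Equiv.subRight_apply,
      sub_add_cancel, neg_add']
    exact Sym2.eq_swap
  · exact (Equiv.neg (Fin n)).surjective.range_comp γ

theorem SameContour.trans {γ₁ γ₂ γ₃ : Fin n → ℤ × ℤ} (h : SameContour γ₁ γ₂)
    (h' : SameContour γ₂ γ₃) : SameContour γ₁ γ₃ :=
  ⟨h'.1, h'.2.1.trans h.2.1, h'.2.2.1.trans h.2.2.1, h'.2.2.2.1.trans h.2.2.2.1,
    h'.2.2.2.2.trans h.2.2.2.2⟩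

theorem exists_fst_neg {γ : Fin n → ℤ × ℤ} (hγ : IsContour γ) (hs : Surrounds γ) :
    ∃ i, (γ i).1 < 0 := by
  by_contra! h
  refine Nat.not_even_iff_odd.2 hs ?_
  convert even_card_ne_succ fun i => decide (0 ≤ (γ i).2) using 4 with i
  have h₀ := h i
  have h₁ := hγ.2 i
  simp only [UnitStep, Prod.ext_iff, Prod.fst_sub, Prod.snd_sub] at h₁
  rw [ne_eq, decide_eq_decide]
  omega

/-- A contour surrounding the origin can be traversed so that it crosses the positive ray
upwards. -/
theorem exists_upward_crossing {γ : Fin n → ℤ × ℤ} (hγ : IsContour γ) (hs : Surrounds γ) :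
    ∃ γ', SameContour γ γ' ∧ ∃ i, 0 ≤ (γ' i).1 ∧ (γ' i).2 = -1 ∧ step γ' i = (0, 1) := by
  obtain ⟨i, hi⟩ := Finset.card_pos.1 hs.pos
  obtain ⟨h₁, h₂, h₃ | h₃⟩ := (Finset.mem_filter.1 hi).2
  · refine ⟨γ, by simpa using sameContour_rotate hγ 0, i, h₂, h₃.1, ?_⟩
    ext <;> simp [step, h₁, h₃]
  · refine ⟨_, sameContour_reverse hγ, -(i + 1), ?_, ?_, ?_⟩
    · simpa [← h₁] using h₂
    · simpa using h₃.2
    · rw [step_reverse]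
      ext <;> simp [step, h₁, h₃]

theorem exists_turn {γ : Fin n → ℤ × ℤ} {i : Fin n} (hi : step γ i = (0, 1)) :
    ∃ d : ℕ, step γ (i - d) ≠ step γ (i - d - 1) := by
  by_contra! h
  have h₁ (d : ℕ) : step γ (i - d) = (0, 1) := by
    induction d with
    | zero => simpa using hi
    | succ d ih =>
      rw [← ih, h d]
      push_cast
      rw [sub_sub]
  have h₂ (j : Fin n) : (γ (j + 1)).2 - (γ j).2 = 1 := by
    have := h₁ (i - j).val
    simp only [Fin.cast_val_eq_self, sub_sub_cancel] at this
    simpa [step] using congrArg Prod.snd this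
  have h₃ : ∑ j, ((γ (j + 1)).2 - (γ j).2) = 0 := by
    rw [Finset.sum_sub_distrib, sub_eq_zero]
    exact Equiv.sum_comp (Equiv.addRight (1 : Fin n)) fun j => (γ j).2
  simp [h₂, NeZero.ne n] at h₃

/-- A parametrization starting at the lower end of a vertical side that crosses the positive
ray. -/
structure Normalized (γ : Fin n → ℤ × ℤ) : Prop where
  isContour : IsContour γ
  step_zero : step γ 0 = (0, 1)
  turn_zero : step γ 0 ≠ step γ (0 - 1)
  fst_nonneg : 0 ≤ (γ 0).1
  fst_lt : (γ 0).1 < (n / 2 : ℕ)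
  snd_neg : (γ 0).2 < 0
  le_snd : -(n / 2 : ℕ) ≤ (γ 0).2
  exists_fst_neg : ∃ i, (γ i).1 < 0

theorem exists_normalized {γ : Fin n → ℤ × ℤ} (hγ : IsContour γ) (hs : Surrounds γ) :
    ∃ γ', SameContour γ γ' ∧ Normalized γ' := by
  obtain ⟨γ₁, h₁, i, hi₁, hi₂, hi₃⟩ := exists_upward_crossing hγ hs
  have hturn := exists_turn hi₃
  classical
  set d := Nat.find hturn with hd
  have hup (e : ℕ) (he : e ≤ d) : step γ₁ (i - e) = (0, 1) ∧
      γ₁ (i - e) = ((γ₁ i).1, -1 - (e : ℤ)) := by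
    induction e with
    | zero => simp [hi₃, ← hi₂]
    | succ e ih =>
      obtain ⟨ih₁, ih₂⟩ := ih (by omega)
      have h₂ := not_not.1 (Nat.find_min hturn (show e < Nat.find hturn by omega))
      have h₃ : i - ((e + 1 : ℕ) : Fin n) = i - e - 1 := by push_cast; ring
      rw [h₃, ← h₂]
      refine ⟨ih₁, ?_⟩
      have h₄ := step_sub_one γ₁ (i - e)
      rw [← h₂, ih₁, ih₂] at h₄
      rw [eq_sub_iff_add_eq, ← eq_sub_iff_add_eq'] at h₄
      rw [h₄]
      ext
      · simp
      · push_cast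
        simp
        ring
  obtain ⟨hd₁, hd₂⟩ := hup d le_rfl
  have h₂ := sameContour_rotate h₁.1 (i - d)
  have h₃ := h₁.trans h₂
  refine ⟨_, h₃, ?_⟩
  obtain ⟨j, hj⟩ := exists_fst_neg hγ hs
  obtain ⟨k, hk⟩ : γ j ∈ Set.range fun j => γ₁ (j + (i - d)) := by
    rw [h₃.2.2.2.2]
    exact ⟨j, rfl⟩
  have hx := two_mul_sub_le (fun j => (γ₁ j).1) (fun j => by simpa using (h₁.1.2 j).abs_le.1)
    (i - d) (k + (i - d))
  have hy := two_mul_sub_le (fun j => (γ₁ j).2) (fun j => by simpa using (h₁.1.2 j).abs_le.2)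
    (i + 1) (i - d)
  have hi₄ : (γ₁ (i + 1)).2 = 0 := by
    have := congrArg Prod.snd hi₃
    simp only [step, Prod.snd_sub] at this
    omega
  simp only [hk, hd₂, hi₄] at hx hy
  refine ⟨h₂.1, ?_, ?_, ?_, ?_, ?_, ?_, k, ?_⟩
  · simpa [step_rotate] using hd₁
  · have := Nat.find_spec hturn
    rw [step_rotate, step_rotate]
    convert this using 2
    · simp [hd]
    · simp only [← hd]
      ring_nf
  · simpa [hd₂] using hi₁
  · simp only [zero_add, hd₂]
    omega
  · simp only [zero_add, hd₂]
    omega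
  · simp only [zero_add, hd₂]
    omega
  · simpa [hk] using hj

/-- The turn between consecutive steps `u` and `v`: `none` for no turn, and otherwise whether
the turn is to the left. -/
def turnCode (u v : ℤ × ℤ) : Option Bool :=
  if v = u then none else some (decide (v = (-u.2, u.1)))

theorem turnCode_isSome {u v : ℤ × ℤ} : (turnCode u v).isSome ↔ v ≠ u := by
  unfold turnCode
  split_ifs <;> simp_all

theorem turnCode_injective {u v w : ℤ × ℤ} (hu : UnitStep u) (hv : UnitStep v)
    (hw : UnitStep w) (hvu : v ≠ -u) (hwu : w ≠ -u) (h : turnCode u v = turnCode u w) :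
    v = w := by
  rcases hu with rfl | rfl | rfl | rfl <;> rcases hv with rfl | rfl | rfl | rfl <;>
    rcases hw with rfl | rfl | rfl | rfl <;> simp_all [turnCode]

/-- The turn at the vertex with index `k`. -/
def turnAt (γ : Fin n → ℤ × ℤ) (k : ℕ) : Option Bool :=
  turnCode (step γ ((k : Fin n) - 1)) (step γ k)

theorem turnAt_isSome {γ : Fin n → ℤ × ℤ} {k : ℕ} :
    (turnAt γ k).isSome ↔ step γ (k : Fin n) ≠ step γ ((k : Fin n) - 1) :=
  turnCode_isSome

theorem card_filter_fin (p : Fin n → Prop) [DecidablePred p] :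
    (Finset.univ.filter p).card = ∑ k ∈ Finset.range n, if p (k : Fin n) then 1 else 0 := by
  rw [Finset.card_filter, Finset.sum_range]
  simp

theorem wordOf_turnAt_mem {γ : Fin n → ℤ × ℤ} (hγ : Normalized γ) :
    wordOf (turnAt γ) n ∈ turnWordsTurning (rCount γ) (n - rCount γ) (rCount γ - mCount γ) := by
  have hr : rCount γ = ∑ k ∈ Finset.range n, if (turnAt γ k).isSome then 1 else 0 := by
    rw [rCount_eq, card_filter_fin]
    simp only [turnAt_isSome]
  have hm : mCount γ = ∑ k ∈ Finset.range n,
      if (turnAt γ k).isSome ∧ (turnAt γ (k + 1)).isSome then 1 else 0 := by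
    rw [mCount_eq, card_filter_fin]
    simp only [turnAt_isSome, Nat.cast_succ, add_sub_cancel_right]
  have hz : ∑ k ∈ Finset.range n, (if (turnAt γ k).isNone then 1 else 0) + rCount γ = n := by
    rw [hr, ← Finset.sum_add_distrib]
    trans ∑ k ∈ Finset.range n, 1
    · refine Finset.sum_congr rfl fun k _ => ?_
      cases turnAt γ k <;> simp
    · simp
  have hg : ∑ k ∈ Finset.range n,
      (if (turnAt γ k).isSome ∧ ¬ (turnAt γ (k + 1)).isSome then 1 else 0) + mCount γ =
        rCount γ := by
    rw [hr, hm, ← Finset.sum_add_distrib]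
    refine Finset.sum_congr rfl fun k _ => ?_
    cases turnAt γ k <;> cases turnAt γ (k + 1) <;> simp
  have h₀ : (turnAt γ 0).isSome := turnAt_isSome.2 (by simpa using hγ.turn_zero)
  refine ⟨⟨?_, ?_, ?_⟩, ?_⟩
  · rw [countP_wordOf, hr]
  · rw [countP_wordOf]
    omega
  · rw [descents_wordOf]
    · omega
    · rw [turnAt_isSome]
      simpa using hγ.turn_zero
  · intro h
    simp_all [wordOf, List.head?_range, NeZero.ne n]

theorem Normalized.step_ne_neg {γ : Fin n → ℤ × ℤ} (hγ : Normalized γ) (i : Fin n) :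
    step γ i ≠ -step γ (i - 1) := by
  intro h
  rw [step_sub_one, step, neg_sub, sub_left_inj] at h
  have h₁ := hγ.isContour.1 h
  have h₂ : ((2 : ℕ) : Fin n) = 0 := by
    push_cast
    linear_combination h₁
  have h₃ : n ≤ 2 := Nat.le_of_dvd two_pos ((Fin.natCast_eq_zero).1 h₂)
  obtain ⟨k, hk⟩ := hγ.exists_fst_neg
  have h₄ := congrArg Prod.fst hγ.step_zero
  have h₅ := hγ.fst_nonneg
  simp only [step, Prod.fst_sub, zero_add] at h₄
  have h₆ : k = 0 ∨ k = 1 := by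
    have := k.isLt
    have h₇ : k.val = 0 ∨ k.val = 1 := by omega
    rw [← Fin.cast_val_eq_self k]
    rcases h₇ with h₇ | h₇ <;> simp [h₇]
  rcases h₆ with rfl | rfl <;> omega

theorem Normalized.eq_of_wordOf_eq {γ γ' : Fin n → ℤ × ℤ} (hγ : Normalized γ)
    (hγ' : Normalized γ') (h₀ : γ 0 = γ' 0)
    (h : wordOf (turnAt γ) n = wordOf (turnAt γ') n) : γ = γ' := by
  have hcode : ∀ k < n, turnAt γ k = turnAt γ' k := by
    simpa [wordOf] using h
  have key (k : ℕ) (hk : k < n) :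
      γ (k : Fin n) = γ' k ∧ step γ (k : Fin n) = step γ' k := by
    induction k with
    | zero => simp [h₀, hγ.step_zero, hγ'.step_zero]
    | succ k ih =>
      obtain ⟨ih₁, ih₂⟩ := ih (by omega)
      have h₁ := hcode (k + 1) hk
      have h₂ := hγ.step_ne_neg ((k : Fin n) + 1)
      have h₃ := hγ'.step_ne_neg ((k : Fin n) + 1)
      simp only [turnAt, Nat.cast_succ, add_sub_cancel_right] at h₁ h₂ h₃ ⊢
      constructor
      · simp only [step, ih₁] at ih₂
        exact sub_left_injective ih₂
      · rw [← ih₂] at h₁ h₃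
        exact turnCode_injective (hγ.isContour.2 _) (hγ.isContour.2 _) (hγ'.isContour.2 _)
          h₂ h₃ h₁
  ext1 i
  simpa using (key i.val i.isLt).1

end Cycles

/-- The possible starting points of a normalized contour with `n` bonds. -/
noncomputable def startBox (n : ℕ) : Finset (ℤ × ℤ) :=
  Finset.Ico 0 ((n / 2 : ℕ) : ℤ) ×ˢ Finset.Ico (-((n / 2 : ℕ) : ℤ)) 0

theorem card_startBox (n : ℕ) : (startBox n).card = (n / 2) * (n / 2) := by
  rw [startBox, Finset.card_product, Int.card_Ico, Int.card_Ico]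
  congr 1
  omega

theorem encard_contours_le (n r m : ℕ) [NeZero n] :
    {E : Set (Sym2 (ℤ × ℤ)) | ∃ γ : Fin n → ℤ × ℤ, IsContour γ ∧ Surrounds γ ∧
        rCount γ = r ∧ mCount γ = m ∧ E = edgeSet γ}.encard ≤
      ((n / 2) * (n / 2) * (2 ^ r * r.choose (r - m) * compositionCount (n - r) (r - m)) : ℕ) := by
  set S := {E : Set (Sym2 (ℤ × ℤ)) | ∃ γ : Fin n → ℤ × ℤ, IsContour γ ∧ Surrounds γ ∧
        rCount γ = r ∧ mCount γ = m ∧ E = edgeSet γ}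
  have hS : ∀ E ∈ S, ∃ γ : Fin n → ℤ × ℤ, Normalized γ ∧ rCount γ = r ∧ mCount γ = m ∧
      edgeSet γ = E := by
    rintro E ⟨γ, h₁, h₂, h₃, h₄, rfl⟩
    obtain ⟨γ', ⟨-, h₅, h₆, h₇, -⟩, h₈⟩ := exists_normalized h₁ h₂
    exact ⟨γ', h₈, h₅.trans h₃, h₆.trans h₄, h₇⟩
  choose! γ hγ hr hm hE using hS
  have hmaps : Set.MapsTo (fun E => (γ E 0, wordOf (turnAt (γ E)) n)) S
      ((startBox n : Set (ℤ × ℤ)) ×ˢ turnWordsTurning r (n - r) (r - m)) := by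
    intro E hES
    have h := hγ E hES
    refine ⟨?_, by simpa [hr E hES, hm E hES] using wordOf_turnAt_mem h⟩
    simpa [startBox] using ⟨⟨h.fst_nonneg, h.fst_lt⟩, h.le_snd, h.snd_neg⟩
  have hinj : Set.InjOn (fun E => (γ E 0, wordOf (turnAt (γ E)) n)) S := by
    intro E hES E' hES' h
    obtain ⟨h₁, h₂⟩ := Prod.mk.inj h
    rw [← hE E hES, ← hE E' hES', (hγ E hES).eq_of_wordOf_eq (hγ E' hES') h₁ h₂]
  refine (Set.encard_le_encard_of_injOn hmaps hinj).trans ?_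
  rw [Set.encard_prod, Set.encard_coe_eq_coe_finsetCard, card_startBox, Nat.cast_mul _ (_ * _ * _)]
  exact mul_le_mul_right (encard_turnWords_le _ r (n - r) (r - m) rfl).1 _

theorem mCount_le_rCount {n : ℕ} [NeZero n] (γ : Fin n → ℤ × ℤ) : mCount γ ≤ rCount γ :=
  Finset.card_le_card (Finset.monotone_filter_right _ fun _ _ h => h.1)

/-- The set of contours (identified with their edge sets) surrounding the origin,
with `n` bonds, `r` sides and `m` sides of length one, is finite with cardinality
at most `(n²/4)·2^r·C(r,m)·C(n-r-1, r-m-1)`. -/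
theorem contour_count_bound (n r m : ℕ) [NeZero n] :
    {E : Set (Sym2 (ℤ × ℤ)) | ∃ γ : Fin n → ℤ × ℤ, IsContour γ ∧ Surrounds γ ∧
        rCount γ = r ∧ mCount γ = m ∧ E = edgeSet γ}.Finite ∧
    (({E : Set (Sym2 (ℤ × ℤ)) | ∃ γ : Fin n → ℤ × ℤ, IsContour γ ∧ Surrounds γ ∧
        rCount γ = r ∧ mCount γ = m ∧ E = edgeSet γ}.ncard : ℚ) ≤
      (n : ℚ) ^ 2 / 4 * 2 ^ r * (r.choose m) * ((n - r - 1).choose (r - m - 1))) := by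
  have hle := encard_contours_le n r m
  set S := {E : Set (Sym2 (ℤ × ℤ)) | ∃ γ : Fin n → ℤ × ℤ, IsContour γ ∧ Surrounds γ ∧
        rCount γ = r ∧ mCount γ = m ∧ E = edgeSet γ}
  have hfin : S.Finite := Set.finite_of_encard_le_coe hle
  refine ⟨hfin, ?_⟩
  rcases S.eq_empty_or_nonempty with hS | ⟨E, γ, -, -, rfl, rfl, -⟩
  · rw [hS, Set.ncard_empty, Nat.cast_zero]
    positivity
  have hmr := mCount_le_rCount γ
  rw [← hfin.cast_ncard_eq, Nat.cast_le, Nat.choose_symm hmr] at hle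
  have hle' := hle.trans (Nat.mul_le_mul_left _ (Nat.mul_le_mul_left _
    (compositionCount_le_choose (n - rCount γ) (rCount γ - mCount γ))))
  have hhalf : ((n / 2 : ℕ) : ℚ) ≤ n / 2 := Nat.cast_div_le
  refine (Nat.cast_le.2 hle').trans ?_
  push_cast
  calc _ ≤ ((n : ℚ) / 2 * (n / 2)) * _ := by gcongr
    _ = _ := by ring
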